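/- There is no monic real polynomial P of degree 4 with all coefficients nonzero whose coefficient signs form the sign pattern (+,+,−,+,+) and such that P has exactly 2 positive and 0 negative real roots, P′ has exactly 2 positive and 1 negative real roots, P″ has exactly 1 positive and 1 negative real root, and P‴ has exactly 0 positive and 1 negative real root, all of these roots being simple. In other words, the couple (σ, SAP) with σ = (+,+,−,+,+) and SAP = ((2,0), (2,1), (1,1), (0,1)) is not realizable. -/

import Mathlib

open Polynomial

/-- Number of sign changes among consecutive entries `s 0, …, s n`. -/
def signChanges (s : ℕ → ℤ) (n : ℕ) : ℕ :=
  ((Finset.range n).filter (fun i => s i * s (i + 1) < 0)).card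

/-- Number of sign preservations among consecutive entries `s 0, …, s n`. -/
def signPres (s : ℕ → ℤ) (n : ℕ) : ℕ :=
  ((Finset.range n).filter (fun i => 0 < s i * s (i + 1))).card

/-- `s` encodes a sign pattern of length `d+1` (entries `s 0, …, s d`, each `±1`,
first entry `+1`). -/
def IsSignPattern (d : ℕ) (s : ℕ → ℤ) : Prop :=
  s 0 = 1 ∧ ∀ i ≤ d, s i = 1 ∨ s i = -1

/-- `pn k = (pos_k, neg_k)`, `k = 0, …, d-1`, is a sequence of admissible pairs (SAP)
for the sign pattern `s` of length `d+1`: each pair is admissible for the truncated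
pattern `σ_k` (of length `d+1-k`, with sign changes `signChanges s (d-k)` and sign
preservations `signPres s (d-k)`), the last entry of `σ_k` is `(-1)^{pos_k}`, and the
Rolle-type inequalities and parity condition hold between consecutive pairs. -/
def IsSAP (d : ℕ) (s : ℕ → ℤ) (pn : ℕ → ℕ × ℕ) : Prop :=
  (∀ k < d,
    (pn k).1 ≤ signChanges s (d - k) ∧
    Even ((signChanges s (d - k) : ℤ) - (pn k).1) ∧
    (pn k).2 ≤ signPres s (d - k) ∧
    Even ((signPres s (d - k) : ℤ) - (pn k).2) ∧
    s (d - k) = (-1) ^ (pn k).1) ∧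
  (∀ k, k + 1 < d →
    (pn k).1 ≤ (pn (k + 1)).1 + 1 ∧
    (pn k).2 ≤ (pn (k + 1)).2 + 1 ∧
    (pn k).1 + (pn k).2 ≤ (pn (k + 1)).1 + (pn (k + 1)).2 + 1 ∧
    Even (((pn (k + 1)).1 : ℤ) + (pn (k + 1)).2 + 3 - (pn k).1 - (pn k).2))

/-- The `k`-th derivative of a real polynomial. -/
noncomputable def iterDeriv : ℕ → Polynomial ℝ → Polynomial ℝ
  | 0, P => P
  | k + 1, P => Polynomial.derivative (iterDeriv k P)

/-- `P` has exactly `pos` positive real roots and exactly `neg` negative real roots,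
all of them simple. -/
def CountRoots (P : Polynomial ℝ) (pos neg : ℕ) : Prop :=
  {x : ℝ | 0 < x ∧ P.eval x = 0}.ncard = pos ∧
  {x : ℝ | x < 0 ∧ P.eval x = 0}.ncard = neg ∧
  ∀ x : ℝ, P.eval x = 0 → (Polynomial.derivative P).eval x ≠ 0

/-- The couple (sign pattern `s`, SAP `pn`) of degree `d` is realizable: there is a
monic real polynomial of degree `d`, with all coefficients nonzero, whose coefficient
signs define the pattern `s` (the sign of the coefficient of `x^(d-i)` is `s i`), and
such that for `k = 0, …, d-1` the `k`-th derivative has exactly `(pn k).1` positive and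
`(pn k).2` negative real roots, all simple. -/
def Realizable (d : ℕ) (s : ℕ → ℤ) (pn : ℕ → ℕ × ℕ) : Prop :=
  ∃ P : Polynomial ℝ, P.Monic ∧ P.natDegree = d ∧
    (∀ j ≤ d, P.coeff j ≠ 0) ∧
    (∀ i ≤ d, 0 < (s i : ℝ) * P.coeff (d - i)) ∧
    ∀ k < d, CountRoots (iterDeriv k P) (pn k).1 (pn k).2

/-- The couple with sign pattern `(+,+,-,+,+)` and SAP `((2,0), (2,1), (1,1), (0,1))`
is not realizable (`d = 4`). -/
theorem stmt18 :
    ¬ Realizable 4 (fun i => if i = 2 then -1 else 1)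
        (fun k => if k = 0 then (2, 0) else if k = 1 then (2, 1)
          else if k = 2 then (1, 1) else (0, 1)) := by
  rintro ⟨P, hm, hd, -, hs, hr⟩
  have h0 := hr 0 (by norm_num)
  simp only [iterDeriv, CountRoots, if_true] at h0
  obtain ⟨hp, hn, -⟩ := h0
  have hP0 : P ≠ 0 := hm.ne_zero
  have hev : ∀ x : ℝ, P.eval x = P.coeff 0 + P.coeff 1 * x + P.coeff 2 * x ^ 2
      + P.coeff 3 * x ^ 3 + P.coeff 4 * x ^ 4 := by
    intro x
    rw [Polynomial.eval_eq_sum_range, hd]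
    simp [Finset.sum_range_succ]
  have c3 : 0 < P.coeff 3 := by simpa using hs 1 (by norm_num)
  have c1 : 0 < P.coeff 1 := by simpa using hs 3 (by norm_num)
  have c0 : 0 < P.coeff 0 := by simpa using hs 4 (by norm_num)
  have hne : {x : ℝ | 0 < x ∧ P.eval x = 0}.Nonempty := by
    apply Set.nonempty_of_ncard_ne_zero
    rw [hp]; norm_num
  obtain ⟨x, hx, hx0⟩ := hne
  have hneg : P.eval (-x) < 0 := by
    have e1 := hev x
    have e2 := hev (-x)
    have p1 : 0 < P.coeff 1 * x := by positivity
    have p3 : 0 < P.coeff 3 * x ^ 3 := by positivity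
    have : P.eval (-x) = P.eval x - 2 * (P.coeff 1 * x) - 2 * (P.coeff 3 * x ^ 3) := by
      rw [e1, e2]; ring
    linarith
  have hpos : 0 < P.eval 0 := by rw [hev 0]; simpa using c0
  obtain ⟨y, hy, hy0⟩ := intermediate_value_Icc (by linarith : -x ≤ 0)
    P.continuous.continuousOn (show (0 : ℝ) ∈ Set.Icc (P.eval (-x)) (P.eval 0) from
      ⟨hneg.le, hpos.le⟩)
  have hy1 : y < 0 := by
    rcases hy.2.lt_or_eq with h | h
    · exact h
    · subst h; exact absurd hy0 hpos.ne'
  have hfin : {x : ℝ | x < 0 ∧ P.eval x = 0}.Finite := by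
    apply (Polynomial.finite_setOf_isRoot hP0).subset
    intro z hz
    exact hz.2
  rw [Set.ncard_eq_zero hfin] at hn
  have : y ∈ {x : ℝ | x < 0 ∧ P.eval x = 0} := ⟨hy1, hy0⟩
  rw [hn] at this
  exact this
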